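/- For every integer m ≥ 0, the polynomial P(2^{2m+1}−1)(x) is congruent to 1 + 2x·(1−δ_{m,0}) + 2·S^e_m(x) modulo 4, where δ_{m,0} equals 1 if m=0 and 0 otherwise, i.e. every coefficient of the difference is divisible by 4. -/

import Mathlib

open Polynomial

/-- The Thue–Morse ±1 sequence: t 0 = 1, t (2n) = t n, t (2n+1) = -t n. -/
def tmSeq : ℕ → ℤ
  | 0 => 1
  | n + 1 => if (n + 1) % 2 = 0 then tmSeq ((n + 1) / 2) else -tmSeq ((n + 1) / 2)
decreasing_by all_goals exact Nat.div_lt_self (Nat.succ_pos n) one_lt_two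

/-- Numerators of the convergents of the Thue–Morse continued fraction. -/
noncomputable def Ptm : ℕ → ℤ[X]
  | 0 => 1
  | 1 => 1
  | n + 2 => Ptm (n + 1) + C (tmSeq (n + 2)) * X * Ptm n

/-- Denominators of the convergents of the Thue–Morse continued fraction. -/
noncomputable def Qtm : ℕ → ℤ[X]
  | 0 => 1
  | 1 => 1 - X
  | n + 2 => Qtm (n + 1) + C (tmSeq (n + 2)) * X * Qtm n

/-- S_m(x) = Σ_{j<m} x^(2^j). -/
noncomputable def Spoly (m : ℕ) : ℤ[X] := ∑ j ∈ Finset.range m, X ^ (2 ^ j)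
/-- S^e_m(x) = Σ_{j<m} x^(2^(2j)). -/
noncomputable def SePoly (m : ℕ) : ℤ[X] := ∑ j ∈ Finset.range m, X ^ (2 ^ (2 * j))
/-- S^o_m(x) = Σ_{j<m} x^(2^(2j+1)). -/
noncomputable def SoPoly (m : ℕ) : ℤ[X] := ∑ j ∈ Finset.range m, X ^ (2 ^ (2 * j + 1))

theorem tmSeq_two_mul (n : ℕ) : tmSeq (2 * n) = tmSeq n := by
  cases n with
  | zero => rfl
  | succ n =>
    rw [show 2 * (n + 1) = (2 * n + 1) + 1 by ring, tmSeq, if_pos (by omega)]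
    congr 1
    omega

theorem tmSeq_two_mul_add_one (n : ℕ) : tmSeq (2 * n + 1) = -tmSeq n := by
  rw [tmSeq, if_neg (by omega)]
  congr 2
  omega

/-- The product of the transfer matrices `!![1, 1; ±x, 0]` along the `m`-th Thue–Morse block
starting with the sign `ε`. -/
def tmBlock {R : Type*} [CommRing R] (x : R) : R → ℕ → Matrix (Fin 2) (Fin 2) R
  | ε, 0 => !![1, 1; ε * x, 0]
  | ε, m + 1 => tmBlock x ε m * tmBlock x (-ε) m

section Block

variable {R : Type*} [CommRing R] (x : R)

theorem rec_eq_tmBlock {r : ℕ → R}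
    (hr : ∀ n, r (n + 2) = r (n + 1) + (tmSeq n : R) * x * r n) (m k : ℕ) :
    r (2 ^ m * k + 2 ^ m + 1) = r (2 ^ m * k + 1) * tmBlock x (tmSeq k : R) m 0 0
      + r (2 ^ m * k) * tmBlock x (tmSeq k : R) m 1 0 ∧
    r (2 ^ m * k + 2 ^ m) = r (2 ^ m * k + 1) * tmBlock x (tmSeq k : R) m 0 1
      + r (2 ^ m * k) * tmBlock x (tmSeq k : R) m 1 1 := by
  induction m generalizing k with
  | zero =>
    simp only [pow_zero, one_mul, tmBlock, Matrix.cons_val', Matrix.cons_val_zero,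
      Matrix.cons_val_one, Matrix.cons_val_fin_one, Matrix.of_apply, mul_one, mul_zero, add_zero,
      and_true]
    rw [show k + 1 + 1 = k + 2 from rfl, hr]
    ring
  | succ m ih =>
    obtain ⟨h1, h2⟩ := ih (2 * k)
    obtain ⟨h3, h4⟩ := ih (2 * k + 1)
    rw [tmSeq_two_mul] at h1 h2
    rw [tmSeq_two_mul_add_one, Int.cast_neg] at h3 h4
    rw [show 2 ^ m * (2 * k + 1) = 2 ^ m * (2 * k) + 2 ^ m by ring, h1, h2] at h3 h4
    rw [show 2 ^ (m + 1) * k = 2 ^ m * (2 * k) by ring,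
      show 2 ^ m * (2 * k) + 2 ^ (m + 1) = 2 ^ m * (2 * k) + 2 ^ m + 2 ^ m by ring, h3, h4]
    simp only [tmBlock, Matrix.mul_apply, Fin.sum_univ_two]
    constructor <;> ring

theorem det_tmBlock_one (ε : R) (hε : ε ^ 2 = 1) : (tmBlock x ε 1).det = -x ^ 2 := by
  simp only [tmBlock, Matrix.det_mul, Matrix.det_fin_two_of]
  linear_combination (-x ^ 2) * hε

theorem det_tmBlock_add_two (ε : R) (hε : ε ^ 2 = 1) (m : ℕ) :
    (tmBlock x ε (m + 2)).det = x ^ 2 ^ (m + 2) := by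
  induction m generalizing ε with
  | zero =>
    rw [tmBlock, Matrix.det_mul, det_tmBlock_one x ε hε, det_tmBlock_one x (-ε) (by simpa)]
    ring
  | succ m ih =>
    rw [tmBlock, Matrix.det_mul, ih ε hε, ih (-ε) (by simpa)]
    ring

theorem trace_tmBlock_neg (ε : R) (m : ℕ) :
    (tmBlock x (-ε) (m + 1)).trace = (tmBlock x ε (m + 1)).trace := by
  rw [tmBlock, tmBlock, neg_neg, Matrix.trace_mul_comm]

theorem trace_mul_mul_mul (M N : Matrix (Fin 2) (Fin 2) R) :
    (M * N * (N * M)).trace = M.trace * N.trace * (M * N).trace - N.det * M.trace ^ 2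
      - M.det * N.trace ^ 2 + 2 * M.det * N.det := by
  simp only [Matrix.trace_fin_two, Matrix.det_fin_two, Matrix.mul_apply, Fin.sum_univ_two]
  ring

theorem mul_mul_mul_apply_one_zero (M N : Matrix (Fin 2) (Fin 2) R) :
    (M * N * (N * M)) 1 0 = N.trace * (M * N).trace * M 1 0 + M.det * N.trace * N 1 0
      - N.det * M.trace * M 1 0 := by
  simp only [Matrix.trace_fin_two, Matrix.det_fin_two, Matrix.mul_apply, Fin.sum_univ_two]
  ring

theorem tmBlock_add_two (ε : R) (m : ℕ) :
    tmBlock x ε (m + 2) =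
      tmBlock x ε m * tmBlock x (-ε) m * (tmBlock x (-ε) m * tmBlock x ε m) := by
  simp only [tmBlock, neg_neg]

theorem trace_tmBlock_one (ε : R) : (tmBlock x ε 1).trace = 1 := by
  simp only [tmBlock, Matrix.trace_fin_two, Matrix.mul_apply, Fin.sum_univ_two,
    Matrix.cons_val', Matrix.cons_val_zero, Matrix.cons_val_one, Matrix.cons_val_fin_one,
    Matrix.of_apply]
  ring

theorem tmBlock_one_apply_one_zero (ε : R) : tmBlock x ε 1 1 0 = ε * x := by
  simp [tmBlock, Matrix.mul_apply]

theorem trace_tmBlock_two (ε : R) (hε : ε ^ 2 = 1) :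
    (tmBlock x ε 2).trace = 1 - 2 * x ^ 2 := by
  simp only [tmBlock, Matrix.trace_fin_two, Matrix.mul_apply, Fin.sum_univ_two,
    Matrix.cons_val', Matrix.cons_val_zero, Matrix.cons_val_one, Matrix.cons_val_fin_one,
    Matrix.of_apply]
  linear_combination (-2 * x ^ 2) * hε

theorem trace_tmBlock_three : (tmBlock x 1 3).trace = 1 + 2 * x ^ 4 := by
  have h := trace_tmBlock_two x 1 (by ring)
  rw [tmBlock] at h
  rw [tmBlock_add_two, trace_mul_mul_mul, h, det_tmBlock_one x 1 (by ring),
    det_tmBlock_one x (-1) (by ring), trace_tmBlock_one, trace_tmBlock_one]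
  ring

theorem trace_tmBlock_add_two (h4 : (4 : R) = 0) (m : ℕ) :
    (tmBlock x 1 (m + 2)).trace = 1 + 2 * x ^ 2 ^ (m + 1) ∧
    (tmBlock x 1 (m + 3)).trace = 1 + 2 * x ^ 2 ^ (m + 2) := by
  induction m with
  | zero =>
    refine ⟨?_, trace_tmBlock_three x⟩
    rw [trace_tmBlock_two x 1 (by ring)]
    linear_combination (-x ^ 2) * h4
  | succ m ih =>
    refine ⟨ih.2, ?_⟩
    have h := ih.2
    rw [tmBlock] at h
    rw [show m + 1 + 3 = m + 2 + 2 from rfl, tmBlock_add_two, trace_mul_mul_mul, h,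
      det_tmBlock_add_two x 1 (by ring), det_tmBlock_add_two x (-1) (by ring),
      trace_tmBlock_neg, ih.1, show m + 1 + 2 = m + 3 from rfl, pow_succ 2 (m + 2), pow_mul,
      pow_succ 2 (m + 1), pow_mul]
    generalize x ^ 2 ^ (m + 1) = y
    grind

theorem tmBlock_odd_apply_one_zero (h4 : (4 : R) = 0) (m : ℕ) :
    tmBlock x 1 (2 * m + 3) 1 0 =
      x * (1 + 2 * x + 2 * ∑ j ∈ Finset.range (m + 1), x ^ 2 ^ (2 * j)) ∧
    tmBlock x (-1) (2 * m + 3) 1 0 =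
      x * (1 + 2 * x + 2 * ∑ j ∈ Finset.range (m + 1), x ^ 2 ^ (2 * j)) - 2 * x := by
  induction m with
  | zero =>
    have h := trace_tmBlock_two x 1 (by ring)
    have h' := trace_tmBlock_two x (-1) (by ring)
    rw [tmBlock] at h h'
    simp only [mul_zero, zero_add, tmBlock_add_two _ _ 1, mul_mul_mul_apply_one_zero, h,
      neg_neg, det_tmBlock_one x 1 (by ring), det_tmBlock_one x (-1) (by ring),
      trace_tmBlock_one, tmBlock_one_apply_one_zero, Finset.sum_range_one, pow_zero, pow_one]
    rw [neg_neg] at h'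
    rw [h']
    constructor <;> grind
  | succ m ih =>
    obtain ⟨h1, h2⟩ := ih
    obtain ⟨hT, hs⟩ := trace_tmBlock_add_two x h4 (2 * m + 1)
    have hs' := trace_tmBlock_neg x 1 (2 * m + 3)
    rw [show 2 * m + 1 + 3 = 2 * m + 3 + 1 from rfl] at hs
    rw [hs] at hs'
    rw [tmBlock] at hs hs'
    rw [show 2 * m + 1 + 2 = 2 * m + 2 + 1 from rfl] at hT
    have hT' := trace_tmBlock_neg x 1 (2 * m + 2)
    rw [hT] at hT'
    have hd := det_tmBlock_add_two x 1 (by ring) (2 * m + 1)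
    have hd' := det_tmBlock_add_two x (-1) (by ring) (2 * m + 1)
    rw [Finset.sum_range_succ, show 2 * (m + 1) + 3 = 2 * m + 3 + 2 from rfl,
      tmBlock_add_two x 1 (2 * m + 3), tmBlock_add_two x (-1) (2 * m + 3),
      mul_mul_mul_apply_one_zero, mul_mul_mul_apply_one_zero]
    simp only [neg_neg] at hs' ⊢
    have hy : x ^ 2 ^ (2 * m + 1 + 2) = (x ^ 2 ^ (2 * (m + 1))) ^ 2 := by
      rw [← pow_mul]; congr 1
    rw [hy] at hs hs' hd hd'
    rw [hs, hs', hT, hT', hd, hd', h1, h2]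
    rw [show 2 * m + 1 + 1 = 2 * (m + 1) by ring]
    generalize x ^ 2 ^ (2 * (m + 1)) = y
    generalize ∑ j ∈ Finset.range (m + 1), x ^ 2 ^ (2 * j) = S
    constructor <;> grind

end Block

theorem X_mul_map_Ptm {R : Type*} [CommRing R] (f : ℤ[X] →+* R) (m : ℕ) :
    f X * f (Ptm (2 ^ m - 1)) = tmBlock (f X) 1 m 1 0 := by
  let r : ℕ → R := fun
    | 0 => 1
    | 1 => 0
    | n + 2 => f X * f (Ptm n)
  have hr (n : ℕ) : r (n + 2) = r (n + 1) + (tmSeq n : R) * f X * r n := by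
    match n with
    | 0 => simp [r, Ptm, tmSeq]
    | 1 => simp [r, Ptm]
    | n + 2 =>
      simp only [r, Ptm, map_add, map_mul, eq_intCast, map_intCast]
      ring
  have h := (rec_eq_tmBlock (f X) hr m 0).1
  rw [show 2 ^ m * 0 + 2 ^ m + 1 = (2 ^ m - 1) + 2 by
    have := Nat.one_le_two_pow (n := m)
    omega] at h
  simpa [r, tmSeq] using h

/-- P(2^(2m+1)−1)(x) ≡ 1 + 2x·(1−δ_{m,0}) + 2·S^e_m(x) (mod 4). -/
theorem Ptm_pow_odd_sub_one_mod_four (m : ℕ) :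
    ∀ k, (4 : ℤ) ∣ (Ptm (2 ^ (2 * m + 1) - 1)
      - (1 + 2 * X * (1 - if m = 0 then 1 else 0) + 2 * SePoly m)).coeff k := by
  intro k
  cases m with
  | zero => simp [Ptm, SePoly]
  | succ m =>
    have h4 : (4 : (ZMod 4)[X]) = 0 := CharP.cast_eq_zero (ZMod 4)[X] 4
    have h := X_mul_map_Ptm (mapRingHom (Int.castRingHom (ZMod 4))) (2 * (m + 1) + 1)
    rw [show 2 * (m + 1) + 1 = 2 * m + 3 by ring, (tmBlock_odd_apply_one_zero _ h4 m).1] at h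
    rw [coe_mapRingHom, map_X] at h
    have h' := isRegular_X.left h
    refine (ZMod.intCast_zmod_eq_zero_iff_dvd _ 4).1 ?_
    rw [← eq_intCast (Int.castRingHom (ZMod 4)), ← coeff_map]
    simp [SePoly, h', Polynomial.map_sum, show 2 * (m + 1) + 1 = 2 * m + 3 by ring]
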